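/- arXiv:2512.17158 — 4 statements merged into one kernel-verified Lean document; each statement's English description precedes it below -/
import Mathlib

section
/- Let L be a nonempty finite index set and for each i in L let T_i > 0 be a positive real number. Define x*_i = (∏_{u ∈ L, u ≠ i} T_u) / (∑_{v ∈ L} ∏_{u ∈ L, u ≠ v} T_u) for each i ∈ L (and x*_i = 1 when L is a singleton). Then x* is a feasible workload allocation and for every feasible workload allocation x over L, max_{i ∈ L} x_i · T_i ≥ max_{i ∈ L} x*_i · T_i; that is, x* minimizes the offloading make-span max_{i ∈ L} x_i · T_i over all feasible allocations. -/
open Finset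

/-- The closed-form workload allocation fraction of server `i`:
`x*_i = (∏_{u ∈ L, u ≠ i} T u) / (∑_{v ∈ L} ∏_{u ∈ L, u ≠ v} T u)`. -/
noncomputable def closedFormAlloc {ι : Type*} [DecidableEq ι]
    (L : Finset ι) (T : ι → ℝ) (i : ι) : ℝ :=
  (∏ u ∈ L.erase i, T u) / (∑ v ∈ L, ∏ u ∈ L.erase v, T u)

theorem sum_prod_erase_pos {ι : Type*} [DecidableEq ι] {L : Finset ι} (hL : L.Nonempty)
    {T : ι → ℝ} (hT : ∀ i ∈ L, 0 < T i) : 0 < ∑ v ∈ L, ∏ u ∈ L.erase v, T u :=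
  sum_pos (fun _ _ => prod_pos fun u hu => hT u (mem_of_mem_erase hu)) hL

theorem closedFormAlloc_nonneg {ι : Type*} [DecidableEq ι] {L : Finset ι}
    {T : ι → ℝ} (hT : ∀ i ∈ L, 0 < T i) (i : ι) : 0 ≤ closedFormAlloc L T i :=
  div_nonneg (prod_nonneg fun u hu => (hT u (mem_of_mem_erase hu)).le)
    (sum_nonneg fun _ _ => prod_nonneg fun u hu => (hT u (mem_of_mem_erase hu)).le)

theorem sum_closedFormAlloc {ι : Type*} [DecidableEq ι] {L : Finset ι} (hL : L.Nonempty)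
    {T : ι → ℝ} (hT : ∀ i ∈ L, 0 < T i) : ∑ i ∈ L, closedFormAlloc L T i = 1 := by
  simp only [closedFormAlloc]
  rw [← sum_div, div_self (sum_prod_erase_pos hL hT).ne']

/-- The closed-form allocation gives every server the same delay. -/
theorem closedFormAlloc_mul {ι : Type*} [DecidableEq ι] {L : Finset ι} (T : ι → ℝ)
    {i : ι} (hi : i ∈ L) :
    closedFormAlloc L T i * T i = (∏ u ∈ L, T u) / ∑ v ∈ L, ∏ u ∈ L.erase v, T u := by
  rw [closedFormAlloc, div_mul_eq_mul_div, prod_erase_mul _ _ hi]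

/-- the closed-form allocation is feasible and minimizes the
make-span `max_{i ∈ L} x_i · T_i` over all feasible allocations. -/
theorem closedFormAlloc_isOptimal {ι : Type*} [DecidableEq ι]
    (L : Finset ι) (hL : L.Nonempty) (T : ι → ℝ) (hT : ∀ i ∈ L, 0 < T i) :
    (∀ i ∈ L, 0 ≤ closedFormAlloc L T i ∧ closedFormAlloc L T i ≤ 1) ∧
    (∑ i ∈ L, closedFormAlloc L T i = 1) ∧
    (∀ x : ι → ℝ, (∀ i ∈ L, 0 ≤ x i ∧ x i ≤ 1) → (∑ i ∈ L, x i = 1) →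
      L.sup' hL (fun i => x i * T i) ≥
        L.sup' hL (fun i => closedFormAlloc L T i * T i)) := by
  have hnonneg := closedFormAlloc_nonneg hT
  have hsum := sum_closedFormAlloc hL hT
  refine ⟨fun i hi => ⟨hnonneg i, ?_⟩, hsum, fun x _ hx => ?_⟩
  · rw [← hsum]
    exact single_le_sum (fun j _ => hnonneg j) hi
  · obtain ⟨i, hi, hle⟩ := exists_le_of_sum_le hL (hsum.trans hx.symm).le
    refine sup'_le hL _ fun j hj => ?_
    calc closedFormAlloc L T j * T j = closedFormAlloc L T i * T i := by
          rw [closedFormAlloc_mul T hj, closedFormAlloc_mul T hi]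
      _ ≤ x i * T i := mul_le_mul_of_nonneg_right hle (hT i hi).le
      _ ≤ L.sup' hL (fun i => x i * T i) := le_sup' (fun i => x i * T i) hi
end

section
/- Let L be a nonempty finite index set and for each i in L let T_i > 0. Then for every feasible workload allocation x over L, max_{i ∈ L} x_i · T_i ≥ (∑_{u ∈ L} 1/T_u)^{-1}. -/
open Finset

/-- for every feasible workload allocation `x` over `L`,
the make-span `max_{i ∈ L} x_i · T_i` is at least `(∑_{u ∈ L} 1/T_u)⁻¹`. -/
theorem makespan_ge_harmonic_bound {ι : Type*}
    (L : Finset ι) (hL : L.Nonempty) (T : ι → ℝ) (hT : ∀ i ∈ L, 0 < T i)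
    (x : ι → ℝ) (hx : ∀ i ∈ L, 0 ≤ x i ∧ x i ≤ 1) (hsum : ∑ i ∈ L, x i = 1) :
    L.sup' hL (fun i => x i * T i) ≥ (∑ u ∈ L, (T u)⁻¹)⁻¹ := by
  have hS : 0 < ∑ u ∈ L, (T u)⁻¹ := Finset.sum_pos (fun i hi => inv_pos.2 (hT i hi)) hL
  rw [ge_iff_le, inv_le_iff_one_le_mul₀ hS, ← hsum, Finset.mul_sum]
  refine Finset.sum_le_sum fun i hi => ?_
  rw [← div_eq_mul_inv, le_div_iff₀ (hT i hi)]
  exact Finset.le_sup' (fun i => x i * T i) hi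
end

section
/- Let L be a nonempty finite index set, and for each i ∈ L let T_i > 0 and w_i ≥ 0. Suppose x* is a feasible workload allocation over L and c is a real number such that T_i · x*_i + w_i = c for all i ∈ L. Then for every feasible workload allocation x over L, max_{i ∈ L} (T_i · x_i + w_i) ≥ c; hence x* minimizes the make-span max_{i ∈ L} (T_i · x_i + w_i) over all feasible allocations. -/
open Finset

/-- equalization-optimality principle. If a feasible allocation
`x*` makes all per-server processing delays `T_i · x*_i + w_i` equal to some
constant `c`, then every feasible allocation `x` has make-span at least `c`;
hence `x*` minimizes the make-span `max_{i ∈ L} (T_i · x_i + w_i)`. -/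
theorem equalizing_alloc_isOptimal {ι : Type*}
    (L : Finset ι) (hL : L.Nonempty) (T w : ι → ℝ)
    (hT : ∀ i ∈ L, 0 < T i) (hw : ∀ i ∈ L, 0 ≤ w i)
    (xstar : ι → ℝ) (hxstar : ∀ i ∈ L, 0 ≤ xstar i ∧ xstar i ≤ 1)
    (hxstarsum : ∑ i ∈ L, xstar i = 1)
    (c : ℝ) (hc : ∀ i ∈ L, T i * xstar i + w i = c) :
    ∀ x : ι → ℝ, (∀ i ∈ L, 0 ≤ x i ∧ x i ≤ 1) → (∑ i ∈ L, x i = 1) →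
      L.sup' hL (fun i => T i * x i + w i) ≥ c := by
  intro x _ hxsum
  obtain ⟨i, hi, hle⟩ := exists_le_of_sum_le hL (hxstarsum.trans hxsum.symm).le
  calc c = T i * xstar i + w i := (hc i hi).symm
    _ ≤ T i * x i + w i := by
      gcongr
      exact (hT i hi).le
    _ ≤ L.sup' hL (fun i => T i * x i + w i) := le_sup' (fun i => T i * x i + w i) hi
end

section
/- Let L be a nonempty finite index set and for each i in L let T_i > 0. Define x*_i = (∏_{u ∈ L, u ≠ i} T_u) / (∑_{v ∈ L} ∏_{u ∈ L, u ≠ v} T_u). Then x* is the unique minimizer of the make-span: for every feasible workload allocation x over L with x ≠ x*, max_{i ∈ L} x_i · T_i > (∑_{u ∈ L} 1/T_u)^{-1} = max_{i ∈ L} x*_i · T_i. -/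
open Finset

/-- The closed-form fraction of a server is inversely proportional to its delay. -/
theorem closedFormAlloc_eq_inv_mul_inv {ι : Type*} [DecidableEq ι]
    {L : Finset ι} {T : ι → ℝ} (hT : ∀ i ∈ L, T i ≠ 0) {i : ι} (hi : i ∈ L) :
    closedFormAlloc L T i = (∑ u ∈ L, (T u)⁻¹)⁻¹ * (T i)⁻¹ := by
  have prod_erase : ∀ v ∈ L, ∏ u ∈ L.erase v, T u = (∏ u ∈ L, T u) * (T v)⁻¹ := fun v hv => by
    rw [← Finset.mul_prod_erase L T hv, mul_comm (T v), mul_inv_cancel_right₀ (hT v hv)]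
  have hP : ∏ u ∈ L, T u ≠ 0 := Finset.prod_ne_zero_iff.mpr hT
  rw [closedFormAlloc, prod_erase i hi, Finset.sum_congr rfl prod_erase, ← Finset.mul_sum,
    mul_div_mul_left _ _ hP, div_eq_inv_mul]

/-- the closed-form allocation is the unique minimizer of the
make-span: its make-span equals `(∑_{u ∈ L} 1/T_u)⁻¹`, and every feasible
allocation that differs from it on `L` has strictly larger make-span. -/
theorem closedFormAlloc_unique_minimizer {ι : Type*} [DecidableEq ι]
    (L : Finset ι) (hL : L.Nonempty) (T : ι → ℝ) (hT : ∀ i ∈ L, 0 < T i) :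
    L.sup' hL (fun i => closedFormAlloc L T i * T i) = (∑ u ∈ L, (T u)⁻¹)⁻¹ ∧
    (∀ x : ι → ℝ, (∀ i ∈ L, 0 ≤ x i ∧ x i ≤ 1) → (∑ i ∈ L, x i = 1) →
      (∃ i ∈ L, x i ≠ closedFormAlloc L T i) →
      L.sup' hL (fun i => x i * T i) > (∑ u ∈ L, (T u)⁻¹)⁻¹) := by
  have hT₀ : ∀ i ∈ L, T i ≠ 0 := fun i hi => (hT i hi).ne'
  have hS : 0 < ∑ u ∈ L, (T u)⁻¹ := Finset.sum_pos (fun i hi => inv_pos.mpr (hT i hi)) hL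
  refine ⟨?_, fun x _ hsum ⟨j, hj, hne⟩ => ?_⟩
  · rw [Finset.sup'_congr hL rfl (g := fun _ => (∑ u ∈ L, (T u)⁻¹)⁻¹), Finset.sup'_const]
    intro i hi
    rw [closedFormAlloc_eq_inv_mul_inv hT₀ hi, inv_mul_cancel_right₀ (hT₀ i hi)]
  · by_contra! hle
    have hx : ∀ i ∈ L, x i ≤ closedFormAlloc L T i := fun i hi => by
      rw [closedFormAlloc_eq_inv_mul_inv hT₀ hi, ← div_eq_mul_inv, le_div_iff₀ (hT i hi)]
      exact (Finset.le_sup' (fun i => x i * T i) hi).trans hle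
    have hlt : ∑ i ∈ L, x i < ∑ i ∈ L, closedFormAlloc L T i :=
      Finset.sum_lt_sum hx ⟨j, hj, lt_of_le_of_ne (hx j hj) hne⟩
    rw [hsum, Finset.sum_congr rfl fun i hi => closedFormAlloc_eq_inv_mul_inv hT₀ hi,
      ← Finset.mul_sum, inv_mul_cancel₀ hS.ne'] at hlt
    exact lt_irrefl _ hlt
end
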